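/- There is a constant C such that for all μ > 1, |N_Ω(μ) − |Ω|μ² + μ/2| ≤ C μ^{2/3}; that is, the lattice point remainder P_Ω(μ) = N_Ω(μ) − |Ω|μ² for the translated lattice ℤ² + (0,−1/4) satisfies P_Ω(μ) = −μ/2 + O(μ^{2/3}). -/

import Mathlib

open MeasureTheory Real Set
open scoped Pointwise

noncomputable def gfun (t : ℝ) : ℝ := (Real.sqrt (1 - t^2) - t * Real.arccos t) / Real.pi

def OmegaSet : Set (ℝ × ℝ) :=
  {p | -1 ≤ p.1 ∧ p.1 ≤ 1 ∧ max 0 (-p.1) ≤ p.2 ∧ p.2 ≤ gfun p.1}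

/-- The number of points of the lattice ℤ² + (0, -1/4) in the dilate μΩ. -/
noncomputable def NOmega (μ : ℝ) : ℕ :=
  Set.ncard {p : ℤ × ℤ | (((p.1 : ℝ)), ((p.2 : ℝ) - 1/4)) ∈ μ • OmegaSet}

noncomputable def ee (x : ℝ) : ℂ := ⟨Real.cos (2 * π * x), Real.sin (2 * π * x)⟩

lemma ee_add (x y : ℝ) : ee (x + y) = ee x * ee y := by
  unfold ee
  apply Complex.ext
  · simp only [Complex.mul_re]; rw [mul_add, Real.cos_add]
  · simp only [Complex.mul_im]; rw [mul_add, Real.sin_add]; ring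

lemma ee_int (k : ℤ) : ee k = 1 := by
  unfold ee
  have h : 2 * π * (k:ℝ) = (k:ℝ) * (2 * π) := by ring
  rw [h]
  apply Complex.ext
  · simp [Real.cos_int_mul_two_pi]
  · have := Real.sin_int_mul_pi (k * 2)
    simp only [Complex.one_im]
    rw [← this]; push_cast; ring_nf

lemma norm_ee (x : ℝ) : ‖ee x‖ = 1 := by
  have : ‖ee x‖ ^ 2 = 1 := by
    rw [← Complex.normSq_eq_norm_sq, Complex.normSq_apply]
    unfold ee
    nlinarith [Real.sin_sq_add_cos_sq (2 * π * x)]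
  nlinarith [norm_nonneg (ee x)]

noncomputable def cc (x : ℝ) : ℝ := Real.cos (π * x) / Real.sin (π * x)
noncomputable def zz (x : ℝ) : ℂ := ⟨1/2, cc x / 2⟩

lemma zz_mul (x : ℝ) (h0 : 0 < x) (h1 : x < 1) : (1 - ee x) * zz x = 1 := by
  have hs : 0 < Real.sin (π * x) := Real.sin_pos_of_pos_of_lt_pi (by positivity)
    (by nlinarith [Real.pi_pos])
  have e1 : 2 * π * x = 2 * (π * x) := by ring
  unfold ee zz cc
  rw [e1, Real.cos_two_mul, Real.sin_two_mul]
  have := Real.sin_sq_add_cos_sq (π * x)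
  apply Complex.ext
  · simp only [Complex.mul_re, Complex.sub_re, Complex.sub_im, Complex.one_re, Complex.one_im]
    field_simp
    nlinarith
  · simp only [Complex.mul_im, Complex.sub_re, Complex.sub_im, Complex.one_re, Complex.one_im]
    field_simp
    ring_nf
    have h2 : Real.sin (π * x) ^ 2 = 1 - Real.cos (π * x) ^ 2 := by linarith
    rw [h2]; ring

lemma cc_anti (x y : ℝ) (h0 : 0 < x) (hxy : x ≤ y) (h1 : y < 1) : cc y ≤ cc x := by
  have hp := Real.pi_pos
  have hs : 0 < Real.sin (π * x) := Real.sin_pos_of_pos_of_lt_pi (by positivity)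
    (by nlinarith)
  have hs' : 0 < Real.sin (π * y) := Real.sin_pos_of_pos_of_lt_pi (by nlinarith)
    (by nlinarith)
  have hd : 0 ≤ Real.sin (π * y - π * x) := Real.sin_nonneg_of_nonneg_of_le_pi (by nlinarith)
    (by nlinarith)
  unfold cc
  rw [div_le_div_iff₀ hs' hs]
  rw [Real.sin_sub] at hd
  nlinarith

lemma sin_lower (x d : ℝ) (hd : 0 < d) (h0 : d ≤ x) (h1 : x ≤ 1 - d) :
    2 * d ≤ Real.sin (π * x) := by
  have hp := Real.pi_pos
  have key : ∀ y, d ≤ y → y ≤ 1/2 → 2 * d ≤ Real.sin (π * y) := by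
    intro y hy hy2
    have := Real.mul_le_sin (x := π * y) (by nlinarith) (by nlinarith)
    have e : 2 / π * (π * y) = 2 * y := by field_simp
    linarith
  rcases le_total x (1/2) with h | h
  · exact key x h0 h
  · have := key (1 - x) (by linarith) (by linarith)
    rwa [mul_sub, mul_one, Real.sin_pi_sub] at this

lemma abs_cc (x d : ℝ) (hd : 0 < d) (h0 : d ≤ x) (h1 : x ≤ 1 - d) : |cc x| ≤ 1 / (2 * d) := by
  have hs := sin_lower x d hd h0 h1
  unfold cc
  rw [abs_div, abs_of_pos (by linarith : 0 < Real.sin (π * x))]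
  exact div_le_div₀ (by norm_num) (Real.abs_cos_le_one _) (by positivity) hs

lemma norm_zz (x d : ℝ) (hd : 0 < d) (h0 : d ≤ x) (h1 : x ≤ 1 - d) : ‖zz x‖ ≤ 1 / (4 * d) := by
  have hs := sin_lower x d hd h0 h1
  have hz : ‖zz x‖ ^ 2 = (1 / (2 * Real.sin (π * x))) ^ 2 := by
    rw [← Complex.normSq_eq_norm_sq, Complex.normSq_apply]
    unfold zz cc
    have := Real.sin_sq_add_cos_sq (π * x)
    have h3 : 0 < Real.sin (π * x) := by linarith
    field_simp
    nlinarith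
  have h3 : 0 < Real.sin (π * x) := by linarith
  have := (sq_eq_sq₀ (norm_nonneg _) (by positivity)).1 hz
  rw [this]
  apply one_div_le_one_div_of_le (by positivity)
  linarith

lemma KL_aux (φ : ℕ → ℝ) (a j : ℕ) (d : ℝ) (hd : 0 < d)
    (h0 : ∀ n, a ≤ n → n ≤ a + j → d ≤ φ (n+1) - φ n ∧ φ (n+1) - φ n ≤ 1 - d)
    (hm : ∀ n, a ≤ n → n < a + j → φ (n+1) - φ n ≤ φ (n+2) - φ (n+1)) :
    ‖∑ n ∈ Finset.Ico a (a+j+1), ee (φ n) + ee (φ (a+j+1)) * zz (φ (a+j+1) - φ (a+j))‖ ≤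
      ‖zz (φ (a+1) - φ a)‖ + (cc (φ (a+1) - φ a) - cc (φ (a+j+1) - φ (a+j))) / 2 := by
  have step : ∀ n, a ≤ n → n ≤ a + j →
      ee (φ n) + ee (φ (n+1)) * zz (φ (n+1) - φ n) = ee (φ n) * zz (φ (n+1) - φ n) := by
    intro n hn hn'
    obtain ⟨h1, h2⟩ := h0 n hn hn'
    have hz := zz_mul (φ (n+1) - φ n) (by linarith) (by linarith)
    have : ee (φ (n+1)) = ee (φ n) * ee (φ (n+1) - φ n) := by
      rw [← ee_add]; congr 1; ring
    rw [this]
    linear_combination (-ee (φ n)) * hz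
  induction j with
  | zero =>
    have := step a le_rfl le_rfl
    simp only [add_zero, Nat.Ico_succ_singleton, Finset.sum_singleton]
    rw [this, norm_mul, norm_ee]; simp
  | succ j ih =>
    have ih' := ih (fun n h1 h2 => h0 n h1 (by omega)) (fun n h1 h2 => hm n h1 (by omega))
      (fun n h1 h2 => step n h1 (by omega))
    have e1 : a + (j + 1) = a + j + 1 := by ring
    rw [e1, Finset.sum_Ico_succ_top (by omega)]
    have st := step (a+j+1) (by omega) (by omega)
    rw [add_assoc, st]
    have e2 : ∑ n ∈ Finset.Ico a (a+j+1), ee (φ n) + ee (φ (a+j+1)) * zz (φ (a+j+1+1) - φ (a+j+1))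
      = (∑ n ∈ Finset.Ico a (a+j+1), ee (φ n) + ee (φ (a+j+1)) * zz (φ (a+j+1) - φ (a+j)))
        + ee (φ (a+j+1)) * (zz (φ (a+j+1+1) - φ (a+j+1)) - zz (φ (a+j+1) - φ (a+j))) := by ring
    rw [e2]
    have h3 : ‖ee (φ (a+j+1)) * (zz (φ (a+j+1+1) - φ (a+j+1)) - zz (φ (a+j+1) - φ (a+j)))‖ ≤
        (cc (φ (a+j+1) - φ (a+j)) - cc (φ (a+j+1+1) - φ (a+j+1))) / 2 := by
      rw [norm_mul, norm_ee, one_mul]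
      have h4 := hm (a+j) (by omega) (by omega)
      have h5 := h0 (a+j) (by omega) (by omega)
      have h6 := h0 (a+j+1) (by omega) (by omega)
      have h7 := cc_anti (φ (a+j+1) - φ (a+j)) (φ (a+j+1+1) - φ (a+j+1)) (by linarith) h4
        (by linarith)
      have : zz (φ (a+j+1+1) - φ (a+j+1)) - zz (φ (a+j+1) - φ (a+j)) =
        (((cc (φ (a+j+1+1) - φ (a+j+1)) - cc (φ (a+j+1) - φ (a+j))) / 2 : ℝ) : ℂ) * Complex.I := by
        unfold zz
        apply Complex.ext <;> simp <;> ring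
      rw [this, norm_mul, Complex.norm_I, mul_one, Complex.norm_real, Real.norm_eq_abs,
        abs_of_nonpos (by linarith)]
      linarith
    refine (norm_add_le _ _).trans ?_
    linarith

lemma KL0 (φ : ℕ → ℝ) (a b : ℕ) (d : ℝ) (hd : 0 < d)
    (h0 : ∀ n, a ≤ n → n < b → d ≤ φ (n+1) - φ n ∧ φ (n+1) - φ n ≤ 1 - d)
    (hm : ∀ n, a ≤ n → n + 1 < b → φ (n+1) - φ n ≤ φ (n+2) - φ (n+1)) :
    ‖∑ n ∈ Finset.Ico a b, ee (φ n)‖ ≤ 1 / d := by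
  rcases le_or_gt b a with h | h
  · rw [Finset.Ico_eq_empty (by omega)]; simp; positivity
  obtain ⟨j, rfl⟩ : ∃ j, b = a + j + 1 := ⟨b - a - 1, by omega⟩
  have := KL_aux φ a j d hd (fun n h1 h2 => h0 n h1 (by omega))
    (fun n h1 h2 => hm n h1 (by omega))
  have ha := h0 a le_rfl (by omega)
  have hb := h0 (a+j) (by omega) (by omega)
  have z1 := norm_zz _ d hd ha.1 ha.2
  have z2 := norm_zz _ d hd hb.1 hb.2
  have c1 := abs_le.1 (abs_cc _ d hd ha.1 ha.2)
  have c2 := abs_le.1 (abs_cc _ d hd hb.1 hb.2)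
  have e : ∑ n ∈ Finset.Ico a (a+j+1), ee (φ n) =
    (∑ n ∈ Finset.Ico a (a+j+1), ee (φ n) + ee (φ (a+j+1)) * zz (φ (a+j+1) - φ (a+j))) -
      ee (φ (a+j+1)) * zz (φ (a+j+1) - φ (a+j)) := by ring
  rw [e]
  refine (norm_sub_le _ _).trans ?_
  rw [norm_mul, norm_ee, one_mul]
  have q1 : 1 / (4 * d) = (1/d) / 4 := by field_simp
  have q2 : 1 / (2 * d) = (1/d) / 2 := by field_simp
  rw [q1] at z1 z2
  rw [q2] at c1 c2
  linarith [c1.1, c1.2, c2.1, c2.2]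

lemma KL (φ : ℕ → ℝ) (a b : ℕ) (k : ℤ) (d : ℝ) (hd : 0 < d)
    (h0 : ∀ n, a ≤ n → n < b → k + d ≤ φ (n+1) - φ n ∧ φ (n+1) - φ n ≤ k + 1 - d)
    (hm : ∀ n, a ≤ n → n + 1 < b → φ (n+1) - φ n ≤ φ (n+2) - φ (n+1)) :
    ‖∑ n ∈ Finset.Ico a b, ee (φ n)‖ ≤ 1 / d := by
  have := KL0 (fun n => φ n - k * n) a b d hd
    (fun n h1 h2 => by have := h0 n h1 h2; push_cast; constructor <;> linarith)
    (fun n h1 h2 => by have := hm n h1 h2; push_cast; linarith)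
  convert this using 3 with n hn
  have e : φ n = (φ n - k * n) + ((k * n : ℤ) : ℝ) := by push_cast; ring
  conv_lhs => rw [e, ee_add, ee_int, mul_one]

lemma growth (D : ℕ → ℝ) (N : ℕ) (l : ℝ) (hD : ∀ n, n + 1 < N → D n + l ≤ D (n+1))
    (m j : ℕ) (h : m + j < N) : D m + l * j ≤ D (m + j) := by
  induction j with
  | zero => simp
  | succ j ih =>
    have h1 := ih (by omega)
    have h2 := hD (m + j) (by omega)
    have e : m + (j + 1) = m + j + 1 := by ring
    rw [e]; push_cast; linarith

lemma card_le (D : ℕ → ℝ) (N : ℕ) (l : ℝ) (hl : 0 < l) (hD : ∀ n, n + 1 < N → D n + l ≤ D (n+1))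
    (x d : ℝ) (hd : 0 < d) (s : Finset ℕ) (hs : ∀ n ∈ s, n < N ∧ x ≤ D n ∧ D n ≤ x + d) :
    (s.card : ℝ) ≤ d / l + 1 := by
  rcases s.eq_empty_or_nonempty with rfl | hne
  · simp; positivity
  have h1 := hs _ (s.min'_mem hne)
  have h2 := hs _ (s.max'_mem hne)
  have hle := s.min'_le_max' hne
  have hsub : s ⊆ Finset.Icc (s.min' hne) (s.max' hne) := fun n hn =>
    Finset.mem_Icc.2 ⟨s.min'_le n hn, s.le_max' n hn⟩
  have hc := Finset.card_le_card hsub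
  rw [Nat.card_Icc] at hc
  obtain ⟨j, hj⟩ := Nat.exists_eq_add_of_le hle
  rw [hj] at h2 hc
  have hg := growth D N l hD (s.min' hne) j h2.1
  have hc' : s.card ≤ j + 1 := by omega
  have hc2 : (s.card : ℝ) ≤ j + 1 := by exact_mod_cast hc'
  have : (j:ℝ) ≤ d / l := by
    rw [le_div_iff₀ hl]; linarith [h1.2.1, h2.2.2]
  linarith

lemma norm_sum_ee_le (φ : ℕ → ℝ) (s : Finset ℕ) : ‖∑ n ∈ s, ee (φ n)‖ ≤ s.card := by
  refine (norm_sum_le _ _).trans ?_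
  simp [norm_ee]

lemma fiber_bound (φ : ℕ → ℝ) (N : ℕ) (l : ℝ) (hl : 0 < l)
    (hD : ∀ n, n + 1 < N → φ (n+1) - φ n + l ≤ φ (n+2) - φ (n+1)) (k : ℤ) (d : ℝ) (hd : 0 < d) :
    ‖∑ n ∈ (Finset.range N).filter (fun n => ⌊φ (n+1) - φ n⌋ = k), ee (φ n)‖ ≤
      2 * (d / l + 1) + 1 / d := by
  set s := (Finset.range N).filter (fun n => ⌊φ (n+1) - φ n⌋ = k) with hs
  have hsm : ∀ n ∈ s, n < N ∧ (k:ℝ) ≤ φ (n+1) - φ n ∧ φ (n+1) - φ n < k + 1 := by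
    intro n hn
    rw [hs, Finset.mem_filter, Finset.mem_range, Int.floor_eq_iff] at hn
    exact hn
  set s1 := s.filter (fun n => φ (n+1) - φ n < k + d)
  set s2 := s.filter (fun n => ¬ (φ (n+1) - φ n < k + d))
  set s3 := s2.filter (fun n => k + 1 - d < φ (n+1) - φ n) with hs3
  set s4 := s2.filter (fun n => ¬ (k + 1 - d < φ (n+1) - φ n)) with hs4
  have hDD : ∀ n, n + 1 < N → (fun n => φ (n+1) - φ n) n + l ≤ (fun n => φ (n+1) - φ n) (n+1) := hD
  have e1 : ∑ n ∈ s, ee (φ n) = ∑ n ∈ s1, ee (φ n) + (∑ n ∈ s3, ee (φ n) + ∑ n ∈ s4, ee (φ n)) := by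
    rw [Finset.sum_filter_add_sum_filter_not s2, Finset.sum_filter_add_sum_filter_not s]
  have b1 : ‖∑ n ∈ s1, ee (φ n)‖ ≤ d / l + 1 := by
    refine (norm_sum_ee_le _ _).trans (card_le _ N l hl hDD k d hd s1 ?_)
    intro n hn
    rw [Finset.mem_filter] at hn
    have := hsm n hn.1
    exact ⟨this.1, this.2.1, hn.2.le⟩
  have b3 : ‖∑ n ∈ s3, ee (φ n)‖ ≤ d / l + 1 := by
    refine (norm_sum_ee_le _ _).trans (card_le _ N l hl hDD (k + 1 - d) d hd s3 ?_)
    intro n hn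
    rw [hs3, Finset.mem_filter, Finset.mem_filter] at hn
    have := hsm n hn.1.1
    refine ⟨this.1, hn.2.le, ?_⟩
    linarith
  have b4 : ‖∑ n ∈ s4, ee (φ n)‖ ≤ 1 / d := by
    have hm4 : ∀ n, n ∈ s4 ↔ n < N ∧ k + d ≤ φ (n+1) - φ n ∧ φ (n+1) - φ n ≤ k + 1 - d := by
      intro n
      rw [hs4, Finset.mem_filter, Finset.mem_filter, not_lt, not_lt, hs, Finset.mem_filter,
        Finset.mem_range, Int.floor_eq_iff]
      constructor
      · rintro ⟨⟨⟨h1, h2⟩, h3⟩, h4⟩; exact ⟨h1, h3, h4⟩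
      · rintro ⟨h1, h2, h3⟩; exact ⟨⟨⟨h1, by linarith, by linarith⟩, h2⟩, h3⟩
    rcases s4.eq_empty_or_nonempty with he | hne
    · rw [he]; simp; positivity
    have mono : ∀ m n, m ≤ n → n < N → φ (m+1) - φ m ≤ φ (n+1) - φ n := by
      intro m n hmn hn
      obtain ⟨j, rfl⟩ := Nat.exists_eq_add_of_le hmn
      have := growth _ N l hDD m j hn
      have : 0 ≤ l * j := by positivity
      linarith
    have h1 := (hm4 _).1 (s4.min'_mem hne)
    have h2 := (hm4 _).1 (s4.max'_mem hne)
    have e4 : s4 = Finset.Ico (s4.min' hne) (s4.max' hne + 1) := by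
      ext n
      rw [Finset.mem_Ico]
      constructor
      · intro hn; exact ⟨s4.min'_le n hn, Nat.lt_succ_of_le (s4.le_max' n hn)⟩
      · rintro ⟨ha, hb⟩
        have hb' : n ≤ s4.max' hne := by omega
        rw [hm4]
        exact ⟨by omega, h1.2.1.trans (mono _ _ ha (by omega)), (mono _ _ hb' h2.1).trans h2.2.2⟩
    rw [e4]
    apply KL φ _ _ k d hd
    · intro n ha hb
      have : n ∈ s4 := by rw [e4, Finset.mem_Ico]; exact ⟨ha, hb⟩
      exact ((hm4 n).1 this).2
    · intro n ha hb
      have := hD n (by omega)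
      linarith
  rw [e1]
  refine (norm_add_le _ _).trans ?_
  have := norm_add_le (∑ n ∈ s3, ee (φ n)) (∑ n ∈ s4, ee (φ n))
  linarith

lemma expsum (f : ℕ → ℝ) (N : ℕ) (l : ℝ) (hl : 0 < l) (hN : (N:ℝ) ≤ 1 / l)
    (hD : ∀ n, n + 1 < N → f (n+1) - f n + l ≤ f (n+2) - f (n+1))
    (hr : ∀ n, n < N → -1 ≤ f (n+1) - f n ∧ f (n+1) - f n ≤ 0) (h : ℕ) (hh : 1 ≤ h) :
    ‖∑ n ∈ Finset.range N, ee (h * f n)‖ ≤ 10 * √(1 / l) * √h := by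
  have hh1 : (1:ℝ) ≤ h := by exact_mod_cast hh
  have hhp : (0:ℝ) < h := by linarith
  have hsq : √(1 / l) * √h = √(h / l) := by
    rw [← Real.sqrt_mul (by positivity)]; congr 1; field_simp
  rw [mul_assoc, hsq]
  rcases lt_or_ge 1 (h * l) with hc | hc
  · have b := norm_sum_ee_le (fun n => h * f n) (Finset.range N)
    rw [Finset.card_range] at b
    refine b.trans (hN.trans ?_)
    have : 1 / l ≤ √(h / l) := by
      apply Real.le_sqrt_of_sq_le
      rw [div_pow, one_pow, div_le_div_iff₀ (by positivity) hl]
      nlinarith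
    nlinarith [Real.sqrt_nonneg (h / l)]
  · set φ : ℕ → ℝ := fun n => h * f n with hφ
    have hmaps : ∀ n ∈ Finset.range N, ⌊φ (n+1) - φ n⌋ ∈ Finset.Icc (-(h:ℤ)) 0 := by
      intro n hn
      have := hr n (Finset.mem_range.1 hn)
      rw [Finset.mem_Icc]
      constructor
      · rw [Int.le_floor]; push_cast; simp only [hφ]; nlinarith
      · have : φ (n+1) - φ n ≤ 0 := by simp only [hφ]; nlinarith
        have := Int.floor_mono this
        simpa using this
    rw [← Finset.sum_fiberwise_of_maps_to hmaps]
    set d := √(h * l) with hd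
    have hdp : 0 < d := Real.sqrt_pos.2 (by positivity)
    have hd2 : d * d = h * l := Real.mul_self_sqrt (by positivity)
    have hd1 : d ≤ 1 := by rw [hd]; exact Real.sqrt_le_one.2 hc
    have hfb : ∀ k ∈ Finset.Icc (-(h:ℤ)) 0, ‖∑ n ∈ Finset.range N with ⌊φ (n+1) - φ n⌋ = k, ee (φ n)‖
        ≤ 5 / d := by
      intro k _
      refine (fiber_bound φ N (h * l) (by positivity) ?_ k d hdp).trans ?_
      · intro n hn
        have := hD n hn
        simp only [hφ]; nlinarith
      · have : d / (h * l) = 1 / d := by rw [← hd2]; field_simp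
        rw [this]
        have h1 : 1 ≤ 1 / d := by rw [le_div_iff₀ hdp]; linarith
        have : 5 / d = 5 * (1 / d) := by ring
        linarith
    refine (norm_sum_le_of_le _ hfb).trans ?_
    rw [Finset.sum_const, Int.card_Icc, nsmul_eq_mul]
    have e : ((0 + 1 - -(h:ℤ)).toNat : ℝ) = h + 1 := by
      have : (0 + 1 - -(h:ℤ)).toNat = h + 1 := by omega
      rw [this]; push_cast; ring
    rw [e]
    have e2 : √(h / l) = h / d := by
      rw [Real.sqrt_eq_iff_mul_self_eq (by positivity) (by positivity)]
      rw [div_mul_div_comm, hd2]; field_simp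
    rw [e2, mul_div_assoc', mul_div_assoc']
    apply div_le_div_of_nonneg_right _ hdp.le
    linarith

noncomputable def BB (x : ℝ) : ℝ := Int.fract x ^ 2 - Int.fract x + 1/6
noncomputable def psi (x : ℝ) : ℝ := Int.fract x - 1/2

lemma BB_hasSum (x : ℝ) :
    HasSum (fun n : ℕ => 1 / (n:ℝ)^2 * (ee (n * x)).re) (π^2 * BB x) := by
  have h := hasSum_one_div_nat_pow_mul_cos (k := 1) one_ne_zero
    (x := Int.fract x) ⟨Int.fract_nonneg x, (Int.fract_lt_one x).le⟩
  convert h using 1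
  · funext n
    congr 1
    unfold ee
    have : 2 * π * (n * x) = 2 * π * n * Int.fract x + ((n * ⌊x⌋ : ℤ) : ℝ) * (2 * π) := by
      rw [Int.fract]; push_cast; ring
    show Real.cos _ = _
    rw [this, Real.cos_add_int_mul_two_pi]
  · unfold BB
    norm_num [Polynomial.bernoulli, Finset.sum_range_succ, Polynomial.eval_add, bernoulli_two, Nat.choose, Nat.factorial]
    ring

lemma psi_lower (x d : ℝ) (hd : 0 < d) (hd1 : d ≤ 1) :
    (BB (x + d) - BB x) / (2 * d) - d ≤ psi x := by
  have h0 := Int.fract_nonneg x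
  have h1 := Int.fract_lt_one x
  have key : BB (x + d) - BB x ≤ 2 * Int.fract x * d + d ^ 2 - d := by
    unfold BB
    rcases lt_or_ge (Int.fract x + d) 1 with h | h
    · have : Int.fract (x + d) = Int.fract x + d := by
        rw [Int.fract_eq_iff]
        exact ⟨by linarith, h, ⌊x⌋, by rw [Int.fract]; ring⟩
      rw [this]; nlinarith
    · have : Int.fract (x + d) = Int.fract x + d - 1 := by
        rw [Int.fract_eq_iff]
        exact ⟨by linarith, by linarith, ⌊x⌋ + 1, by push_cast; rw [Int.fract]; ring⟩
      rw [this]; nlinarith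
  have : (BB (x + d) - BB x) / (2 * d) ≤ psi x + d := by
    rw [div_le_iff₀ (by positivity)]
    unfold psi; nlinarith
  linarith

lemma psi_upper (x d : ℝ) (hd : 0 < d) (hd1 : d ≤ 1) :
    psi x ≤ - (BB (x + -d) - BB x) / (2 * d) + d := by
  have h0 := Int.fract_nonneg x
  have h1 := Int.fract_lt_one x
  have key : BB (x + -d) - BB x ≤ - (2 * Int.fract x * d - d ^ 2 - d) := by
    unfold BB
    rcases le_or_gt 0 (Int.fract x - d) with h | h
    · have : Int.fract (x + -d) = Int.fract x - d := by
        rw [Int.fract_eq_iff]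
        exact ⟨by linarith, by linarith, ⌊x⌋, by rw [Int.fract]; ring⟩
      rw [this]; nlinarith
    · have : Int.fract (x + -d) = Int.fract x - d + 1 := by
        rw [Int.fract_eq_iff]
        exact ⟨by linarith, by linarith, ⌊x⌋ - 1, by push_cast; rw [Int.fract]; ring⟩
      rw [this]; nlinarith
  have : psi x - d ≤ - (BB (x + -d) - BB x) / (2 * d) := by
    rw [le_div_iff₀ (by positivity)]
    unfold psi; nlinarith
  linarith

noncomputable def vv (H h : ℕ) : ℝ := min (1 / (h:ℝ)) (H / (h:ℝ)^2) * √h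

lemma vv_nonneg (H h : ℕ) : 0 ≤ vv H h := by unfold vv; positivity

lemma vv_sum1 (H n : ℕ) : ∑ h ∈ Finset.range (n+1), vv H h ≤ 2 * √n := by
  induction n with
  | zero => simp [vv]
  | succ n ih =>
    rw [Finset.sum_range_succ]
    have hb : 0 < √((n+1 : ℕ) : ℝ) := Real.sqrt_pos.2 (by positivity)
    have hb2 : √((n+1 : ℕ) : ℝ) * √((n+1 : ℕ) : ℝ) = n + 1 := by
      rw [Real.mul_self_sqrt (by positivity)]; push_cast; ring
    have ha : 0 ≤ √(n : ℝ) := Real.sqrt_nonneg _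
    have ha2 : √(n : ℝ) * √(n : ℝ) = n := Real.mul_self_sqrt (by positivity)
    have hv : vv H (n+1) ≤ 1 / √((n+1 : ℕ) : ℝ) := by
      unfold vv
      refine (mul_le_mul_of_nonneg_right (min_le_left _ _) hb.le).trans ?_
      rw [div_mul_eq_mul_div, one_mul, div_le_div_iff₀ (by positivity) hb, hb2]
      push_cast; linarith
    set a := √(n : ℝ)
    set b := √((n+1 : ℕ) : ℝ)
    have : 1 / b ≤ 2 * b - 2 * a := by
      rw [div_le_iff₀ hb]; nlinarith [sq_nonneg (b - a)]
    linarith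

lemma vv_sum2 (H j : ℕ) (hH : 1 ≤ H) :
    ∑ h ∈ Finset.range (H+j+1), vv H h ≤ 2 * √H + 2 * H * (1 / √H - 1 / √((H+j : ℕ) : ℝ)) := by
  induction j with
  | zero => simpa using vv_sum1 H H
  | succ j ih =>
    have e : H + (j + 1) + 1 = (H + j + 1) + 1 := by ring
    have e' : H + (j + 1) = H + j + 1 := by ring
    rw [e, e', Finset.sum_range_succ]
    have hH' : (1:ℝ) ≤ H := by exact_mod_cast hH
    obtain ⟨m, hm⟩ : ∃ m, m = H + j := ⟨_, rfl⟩
    rw [← hm] at ih ⊢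
    have hm0 : (0:ℝ) < m := by rw [hm]; push_cast; positivity
    have hb : 0 < √((m+1 : ℕ) : ℝ) := Real.sqrt_pos.2 (by positivity)
    have hb2 : √((m+1 : ℕ) : ℝ) * √((m+1 : ℕ) : ℝ) = m + 1 := by
      rw [Real.mul_self_sqrt (by positivity)]; push_cast; ring
    have ha : 0 < √(m : ℝ) := Real.sqrt_pos.2 hm0
    have ha2 : √(m : ℝ) * √(m : ℝ) = m := Real.mul_self_sqrt (by positivity)
    have hv : vv H (m+1) ≤ H * (√((m+1 : ℕ) : ℝ) / ((m : ℝ) + 1)^2) := by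
      unfold vv
      refine (mul_le_mul_of_nonneg_right (min_le_right _ _) hb.le).trans ?_
      apply le_of_eq; push_cast; ring
    set a := √(m : ℝ)
    set b := √((m+1 : ℕ) : ℝ)
    have hab : a ≤ b := by nlinarith
    have : b / ((m : ℝ) + 1)^2 ≤ 2 * (1 / a - 1 / b) := by
      rw [← hb2]
      have e1 : b / (b * b)^2 = 1 / (b * b * b) := by field_simp
      have e2 : 2 * (1 / a - 1 / b) = 2 * (b - a) / (a * b) := by field_simp
      rw [e1, e2, div_le_div_iff₀ (by positivity) (by positivity), one_mul]
      have h1 : (b - a) * (b + a) = 1 := by nlinarith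
      have h2 : 1 ≤ 2 * (b - a) * b := by nlinarith
      have h3 : a * b ≤ b * b := by nlinarith
      have h4 : b * b * 1 ≤ b * b * (2 * (b - a) * b) := by gcongr
      nlinarith
    have := mul_le_mul_of_nonneg_left this (by positivity : (0:ℝ) ≤ H)
    nlinarith

lemma vv_sum (H n : ℕ) (hH : 1 ≤ H) : ∑ h ∈ Finset.range n, vv H h ≤ 4 * √H := by
  have h1 := vv_sum2 H n hH
  have h2 : ∑ h ∈ Finset.range n, vv H h ≤ ∑ h ∈ Finset.range (H+n+1), vv H h :=
    Finset.sum_le_sum_of_subset_of_nonneg (Finset.range_mono (by omega))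
      (fun i _ _ => vv_nonneg H i)
  have hH' : (0:ℝ) < H := by exact_mod_cast hH
  have hs : 0 < √(H:ℝ) := Real.sqrt_pos.2 hH'
  have h3 : 2 * (H:ℝ) * (1 / √H) = 2 * √H := by
    have := Real.mul_self_sqrt hH'.le
    field_simp; nlinarith
  have h4 : 0 ≤ 2 * (H:ℝ) * (1 / √((H+n : ℕ) : ℝ)) := by positivity
  rw [mul_sub, h3] at h1
  linarith

lemma norm_ee_sub (y : ℝ) : ‖ee y - 1‖ ≤ 2 * π * |y| := by
  apply le_of_sq_le_sq _ (by positivity)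
  rw [← Complex.normSq_eq_norm_sq, Complex.normSq_apply]
  unfold ee
  simp only [Complex.sub_re, Complex.sub_im, Complex.one_re, Complex.one_im]
  have := Real.one_sub_sq_div_two_le_cos (x := 2 * π * y)
  have h2 := Real.sin_sq_add_cos_sq (2 * π * y)
  have h3 : (2 * π * |y|)^2 = (2 * π * y)^2 := by rw [mul_pow, sq_abs, ← mul_pow]
  rw [h3]
  nlinarith

lemma T_bound (x : ℕ → ℝ) (N H : ℕ) (hH : 1 ≤ H) (K : ℝ) (hK : 0 ≤ K)
    (hE : ∀ h : ℕ, 1 ≤ h → ‖∑ n ∈ Finset.range N, ee (h * x n)‖ ≤ K * √h)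
    (θ : ℝ) (hθ : |θ| = 1 / H) :
    |∑ n ∈ Finset.range N, (BB (x n + θ) - BB (x n))| ≤ 8 * K * √H / H := by
  have hH' : (0:ℝ) < H := by exact_mod_cast hH
  have hp := Real.pi_gt_three
  have hs : HasSum (fun h : ℕ => 1 / (h:ℝ)^2 *
      ((ee (h * θ) - 1) * ∑ n ∈ Finset.range N, ee (h * x n)).re)
      (π^2 * ∑ n ∈ Finset.range N, (BB (x n + θ) - BB (x n))) := by
    have := hasSum_sum (s := Finset.range N) (fun n _ => (BB_hasSum (x n + θ)).sub (BB_hasSum (x n)))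
    convert this using 1
    · rfl
    · funext h
      rw [Finset.mul_sum, Complex.re_sum, Finset.mul_sum]
      apply Finset.sum_congr rfl
      intro n _
      rw [mul_add, ee_add, ← mul_sub, ← Complex.sub_re]
      congr 2; ring
    · rw [Finset.mul_sum]
      apply Finset.sum_congr rfl
      intro n _; ring
  have hterm : ∀ h : ℕ, |1 / (h:ℝ)^2 *
      ((ee (h * θ) - 1) * ∑ n ∈ Finset.range N, ee (h * x n)).re| ≤ 2 * π / H * K * vv H h := by
    intro h
    rcases Nat.eq_zero_or_pos h with rfl | hh
    · simp [vv]
    have hh' : (0:ℝ) < h := by exact_mod_cast hh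
    rw [abs_mul, abs_of_pos (by positivity : 0 < 1 / (h:ℝ)^2)]
    have h1 := Complex.abs_re_le_norm ((ee (h * θ) - 1) * ∑ n ∈ Finset.range N, ee (h * x n))
    rw [norm_mul] at h1
    have h2 := hE h hh
    have h3 := norm_ee_sub (h * θ)
    rw [abs_mul, abs_of_pos hh', hθ] at h3
    have h4 : ‖ee (h * θ) - 1‖ ≤ 2 := by
      refine (norm_sub_le _ _).trans ?_
      rw [norm_ee]; simp; norm_num
    have h5 : 1 / (h:ℝ)^2 * ‖ee (h * θ) - 1‖ ≤ 2 * π / H * min (1 / (h:ℝ)) (H / (h:ℝ)^2) := by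
      rw [mul_min_of_nonneg _ _ (by positivity)]
      apply le_min
      · calc _ ≤ 1 / (h:ℝ)^2 * (2 * π * (h * (1 / H))) := by gcongr
          _ = _ := by field_simp
      · calc _ ≤ 1 / (h:ℝ)^2 * 2 := by gcongr
          _ ≤ 1 / (h:ℝ)^2 * (2 * π) := by gcongr; linarith
          _ = _ := by field_simp
    calc _ ≤ 1 / (h:ℝ)^2 * (‖ee (h * θ) - 1‖ * ‖∑ n ∈ Finset.range N, ee (h * x n)‖) := by gcongr
      _ ≤ 1 / (h:ℝ)^2 * (‖ee (h * θ) - 1‖ * (K * √h)) := by gcongr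
      _ = (1 / (h:ℝ)^2 * ‖ee (h * θ) - 1‖) * (K * √h) := by ring
      _ ≤ (2 * π / H * min (1 / (h:ℝ)) (H / (h:ℝ)^2)) * (K * √h) := by gcongr
      _ = _ := by unfold vv; ring
  have hb : |π^2 * ∑ n ∈ Finset.range N, (BB (x n + θ) - BB (x n))| ≤ 2 * π / H * K * (4 * √H) := by
    refine le_of_tendsto' (hs.tendsto_sum_nat.abs) ?_
    intro m
    refine (Finset.abs_sum_le_sum_abs _ _).trans ?_
    refine (Finset.sum_le_sum (fun h _ => hterm h)).trans ?_
    rw [← Finset.mul_sum]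
    exact mul_le_mul_of_nonneg_left (vv_sum H m hH) (by positivity)
  rw [abs_mul, abs_of_pos (by positivity : 0 < π^2)] at hb
  have e : 2 * π / H * K * (4 * √H) = π * (8 * K * √H / H) := by ring
  rw [e] at hb
  set T := |∑ n ∈ Finset.range N, (BB (x n + θ) - BB (x n))|
  have hT : 0 ≤ T := abs_nonneg _
  have h1 : π * (π * T) ≤ π * (8 * K * √H / H) := by nlinarith
  have h2 := le_of_mul_le_mul_left h1 Real.pi_pos
  nlinarith

lemma psi_sum (x : ℕ → ℝ) (N H : ℕ) (hH : 1 ≤ H) (K : ℝ) (hK : 0 ≤ K)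
    (hE : ∀ h : ℕ, 1 ≤ h → ‖∑ n ∈ Finset.range N, ee (h * x n)‖ ≤ K * √h) :
    |∑ n ∈ Finset.range N, psi (x n)| ≤ N / H + 4 * K * √H := by
  have hH' : (0:ℝ) < H := by exact_mod_cast hH
  have hH1 : (1:ℝ) ≤ H := by exact_mod_cast hH
  have hd : (0:ℝ) < 1 / H := by positivity
  have hd1 : (1:ℝ) / H ≤ 1 := by rw [div_le_one hH']; exact hH1
  have t1 := abs_le.1 (T_bound x N H hH K hK hE (1 / H) (abs_of_pos hd))
  have t2 := abs_le.1 (T_bound x N H hH K hK hE (-(1 / H)) (by rw [abs_neg, abs_of_pos hd]))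
  have e : 8 * K * √H / H = 4 * K * √H * (2 * (1 / H)) := by ring
  have eN : (N:ℝ) / H = N * (1 / H) := by ring
  have hlow : (∑ n ∈ Finset.range N, (BB (x n + 1/H) - BB (x n))) / (2 * (1 / H)) - N / H ≤
      ∑ n ∈ Finset.range N, psi (x n) := by
    have := Finset.sum_le_sum (s := Finset.range N) (fun n _ => psi_lower (x n) (1/H) hd hd1)
    rw [Finset.sum_sub_distrib, ← Finset.sum_div, Finset.sum_const, Finset.card_range,
      nsmul_eq_mul] at this
    rw [eN]; exact this
  have hup : ∑ n ∈ Finset.range N, psi (x n) ≤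
     -(∑ n ∈ Finset.range N, (BB (x n + -(1/H)) - BB (x n))) / (2 * (1 / H)) + N / H := by
    have := Finset.sum_le_sum (s := Finset.range N) (fun n _ => psi_upper (x n) (1/H) hd hd1)
    rw [Finset.sum_add_distrib, ← Finset.sum_div, Finset.sum_neg_distrib, Finset.sum_const,
      Finset.card_range, nsmul_eq_mul] at this
    rw [eN]; exact this
  rw [e] at t1 t2
  rw [abs_le]
  constructor
  · have : -(4 * K * √H) ≤ (∑ n ∈ Finset.range N, (BB (x n + 1/H) - BB (x n))) / (2 * (1 / H)) := by
      rw [le_div_iff₀ (by positivity)]; linarith [t1.1]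
    linarith
  · have : -(∑ n ∈ Finset.range N, (BB (x n + -(1/H)) - BB (x n))) / (2 * (1 / H)) ≤ 4 * K * √H := by
      rw [div_le_iff₀ (by positivity)]; linarith [t2.1]
    linarith

lemma gfun_cont : Continuous gfun := by
  unfold gfun
  have := Real.continuous_arccos
  fun_prop

lemma gfun_deriv (t : ℝ) (h0 : -1 < t) (h1 : t < 1) : HasDerivAt gfun (-(Real.arccos t) / π) t := by
  have hp : 0 < 1 - t^2 := by nlinarith
  have a := (((hasDerivAt_pow 2 t).const_sub 1).sqrt hp.ne')
  have b := (hasDerivAt_id t).mul (Real.hasDerivAt_arccos (by linarith) (by linarith) : HasDerivAt _ _ t)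
  have c := (a.sub b).div_const π
  refine c.congr_deriv ?_
  have hs : 0 < √(1 - t^2) := Real.sqrt_pos.2 hp
  simp only [id]
  congr 1
  field_simp
  push_cast
  ring

lemma gfun_neg (t : ℝ) : gfun (-t) = gfun t + t := by
  unfold gfun
  rw [Real.arccos_neg]
  have := Real.pi_pos
  field_simp
  ring

noncomputable def FF (μ x : ℝ) : ℝ := μ * gfun (x / μ)
noncomputable def dF (μ x : ℝ) : ℝ := -(Real.arccos (x / μ)) / π

lemma FF_cont (μ : ℝ) : Continuous (FF μ) := by
  unfold FF
  have := gfun_cont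
  fun_prop

lemma FF_deriv (μ x : ℝ) (hμ : 0 < μ) (h0 : 0 < x) (h1 : x < μ) :
    HasDerivAt (FF μ) (dF μ x) x := by
  have a := gfun_deriv (x / μ) (by have : 0 < x / μ := by positivity
                                   linarith) (by rw [div_lt_one hμ]; exact h1)
  have b := ((a.comp x ((hasDerivAt_id x).div_const μ)).const_mul μ)
  refine b.congr_deriv ?_
  unfold dF; field_simp

lemma FF_mvt (μ a b : ℝ) (hμ : 0 < μ) (h0 : 0 ≤ a) (hab : a < b) (hb : b ≤ μ) :
    ∃ ξ, a < ξ ∧ ξ < b ∧ FF μ b - FF μ a = dF μ ξ * (b - a) := by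
  obtain ⟨ξ, hξ, h⟩ := exists_hasDerivAt_eq_slope (FF μ) (dF μ) hab (FF_cont μ).continuousOn
    (fun x hx => FF_deriv μ x hμ (by linarith [hx.1]) (by linarith [hx.2]))
  refine ⟨ξ, hξ.1, hξ.2, ?_⟩
  rw [h]; field_simp [sub_ne_zero.2 hab.ne']

lemma dF_mono (μ x y : ℝ) (hμ : 0 < μ) (h : x ≤ y) : dF μ x ≤ dF μ y := by
  unfold dF
  have : Real.arccos (y / μ) ≤ Real.arccos (x / μ) := Real.antitone_arccos (by gcongr)
  have := Real.pi_pos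
  gcongr

lemma dF_le (μ x : ℝ) : dF μ x ≤ 0 := by
  unfold dF
  have := Real.arccos_nonneg (x / μ)
  exact div_nonpos_of_nonpos_of_nonneg (by linarith) Real.pi_pos.le

lemma dF_ge (μ x : ℝ) (hμ : 0 < μ) (h : 0 ≤ x) : -1/2 ≤ dF μ x := by
  unfold dF
  have : Real.arccos (x / μ) ≤ π / 2 := Real.arccos_le_pi_div_two.2 (by positivity)
  rw [le_div_iff₀ Real.pi_pos]; linarith

lemma arccos_expand (x y : ℝ) (hx : -1 ≤ x) (hxy : x ≤ y) (hy : y ≤ 1) :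
    y - x ≤ Real.arccos x - Real.arccos y := by
  have hle : Real.arccos y ≤ Real.arccos x := Real.antitone_arccos hxy
  have := Real.abs_cos_sub_cos_le (Real.arccos y) (Real.arccos x)
  rw [Real.cos_arccos hx (by linarith), Real.cos_arccos (by linarith) hy] at this
  rw [abs_of_nonneg (by linarith), abs_of_nonpos (by linarith)] at this
  linarith

lemma dF_expand (μ x y : ℝ) (hμ : 0 < μ) (h0 : 0 ≤ x) (h : x ≤ y) (hy : y ≤ μ) :
    (y - x) / (π * μ) ≤ dF μ y - dF μ x := by
  have h1 : 0 ≤ x / μ := by positivity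
  have := arccos_expand (x / μ) (y / μ) (by linarith) (by gcongr) (by rw [div_le_one hμ]; exact hy)
  unfold dF
  rw [← sub_div, ← div_div, div_right_comm]
  have := Real.pi_pos
  gcongr
  rw [sub_div]; linarith

lemma FF_second (μ x : ℝ) (hμ : 0 < μ) (h0 : 0 ≤ x) (h : x + 2 ≤ μ) :
    FF μ (x+1) - FF μ x + 1 / (π * μ) ≤ FF μ (x+2) - FF μ (x+1) := by
  obtain ⟨ξ, hξ, hh⟩ := exists_hasDerivAt_eq_slope (fun u => FF μ (u+1) - FF μ u)
    (fun u => dF μ (u+1) - dF μ u) (lt_add_one x)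
    (by have := FF_cont μ
        fun_prop)
    (fun u hu => by
      have a := FF_deriv μ u hμ (by linarith [hu.1]) (by linarith [hu.2])
      have b := FF_deriv μ (u+1) hμ (by linarith [hu.1]) (by linarith [hu.2])
      exact (b.comp_add_const u 1).sub a)
  have := dF_expand μ ξ (ξ+1) hμ (by linarith [hξ.1]) (by linarith) (by linarith [hξ.2])
  have e : x + 1 + 1 = x + 2 := by ring
  simp only [add_sub_cancel_left, div_one, e] at hh this
  linarith

lemma FF_self (μ : ℝ) (hμ : 0 < μ) : FF μ μ = 0 := by
  unfold FF gfun; rw [div_self hμ.ne']; simp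

lemma FF_bounds (μ x : ℝ) (hμ : 0 < μ) (h0 : 0 ≤ x) (h : x ≤ μ) :
    0 ≤ FF μ x ∧ FF μ x ≤ (μ - x) / 2 := by
  rcases h.eq_or_lt with rfl | h
  · rw [FF_self x hμ]; simp
  obtain ⟨ξ, h1, h2, h3⟩ := FF_mvt μ x μ hμ h0 h le_rfl
  rw [FF_self μ hμ] at h3
  have a := dF_le μ ξ
  have b := dF_ge μ ξ hμ (by linarith)
  constructor <;> nlinarith

lemma FF_lin (μ a x : ℝ) (hμ : 0 < μ) (h0 : 0 ≤ a) (hab : a ≤ x) (hx : x ≤ a + 1) (hb : a + 1 ≤ μ) :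
    FF μ a + dF μ a * (x - a) ≤ FF μ x ∧ FF μ x ≤ FF μ a + dF μ (a+1) * (x - a) := by
  rcases hab.eq_or_lt with rfl | h
  · simp
  obtain ⟨ξ, h1, h2, h3⟩ := FF_mvt μ a x hμ h0 h (by linarith)
  have m1 := dF_mono μ a ξ hμ h1.le
  have m2 := dF_mono μ ξ (a+1) hμ (by linarith)
  constructor <;> nlinarith

lemma int_lin (c m a : ℝ) : ∫ x in a..(a+1), (c + m * (x - a)) = c + m / 2 := by
  rw [intervalIntegral.integral_add (by simp) (by apply Continuous.intervalIntegrable; fun_prop)]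
  rw [intervalIntegral.integral_const_mul, intervalIntegral.integral_comp_sub_right (fun x => x)]
  simp; ring

lemma trap_one (μ a : ℝ) (hμ : 0 < μ) (h0 : 0 ≤ a) (hb : a + 1 ≤ μ) :
    |(∫ x in a..(a+1), FF μ x) - (FF μ a + FF μ (a+1)) / 2| ≤ (dF μ (a+1) - dF μ a) / 2 := by
  have i1 : ∫ x in a..(a+1), (FF μ a + dF μ a * (x - a)) ≤ ∫ x in a..(a+1), FF μ x := by
    apply intervalIntegral.integral_mono_on (by linarith)
    · apply Continuous.intervalIntegrable; fun_prop
    · exact (FF_cont μ).intervalIntegrable _ _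
    · intro x hx; exact (FF_lin μ a x hμ h0 hx.1 hx.2 hb).1
  have i2 : ∫ x in a..(a+1), FF μ x ≤ ∫ x in a..(a+1), (FF μ a + dF μ (a+1) * (x - a)) := by
    apply intervalIntegral.integral_mono_on (by linarith)
    · exact (FF_cont μ).intervalIntegrable _ _
    · apply Continuous.intervalIntegrable; fun_prop
    · intro x hx; exact (FF_lin μ a x hμ h0 hx.1 hx.2 hb).2
  rw [int_lin] at i1 i2
  have l := FF_lin μ a (a+1) hμ h0 (by linarith) le_rfl hb
  rw [add_sub_cancel_left] at l
  rw [abs_le]; constructor <;> linarith [l.1, l.2]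

lemma trap (μ : ℝ) (hμ : 0 < μ) (M : ℕ) (hM : (M:ℝ) ≤ μ) :
    |(∫ x in (0:ℝ)..M, FF μ x) - (∑ n ∈ Finset.range M, FF μ n - FF μ 0 / 2 + FF μ M / 2)| ≤
      (dF μ M - dF μ 0) / 2 := by
  induction M with
  | zero => simp
  | succ M ih =>
    push_cast at hM ⊢
    have h1 := ih (by linarith)
    have h2 := trap_one μ M hμ (by positivity) hM
    rw [Finset.sum_range_succ, ← intervalIntegral.integral_add_adjacent_intervals (b := (M:ℝ))
      ((FF_cont μ).intervalIntegrable _ _) ((FF_cont μ).intervalIntegrable _ _)]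
    rw [abs_le] at h1 h2 ⊢
    constructor <;> linarith [h1.1, h1.2, h2.1, h2.2]

lemma trap_full (μ : ℝ) (hμ : 0 < μ) (M : ℕ) (hM : (M:ℝ) ≤ μ) (hM1 : μ < M + 1) :
    |2 * (∫ x in (0:ℝ)..μ, FF μ x) - (2 * ∑ n ∈ Finset.range M, FF μ n - FF μ 0)| ≤ 3 := by
  have h1 := trap μ hμ M hM
  have hb := FF_bounds μ M hμ (by positivity) hM
  have d1 := dF_le μ M
  have d2 := dF_ge μ 0 hμ le_rfl
  have i1 : 0 ≤ ∫ x in (M:ℝ)..μ, FF μ x :=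
    intervalIntegral.integral_nonneg hM (fun x hx => (FF_bounds μ x hμ (by
      have : (0:ℝ) ≤ M := by positivity
      linarith [hx.1]) hx.2).1)
  have i2 : ∫ x in (M:ℝ)..μ, FF μ x ≤ ∫ x in (M:ℝ)..μ, 1 := by
    apply intervalIntegral.integral_mono_on hM
    · exact (FF_cont μ).intervalIntegrable _ _
    · simp
    · intro x hx
      have := (FF_bounds μ x hμ (by
        have : (0:ℝ) ≤ M := by positivity
        linarith [hx.1]) hx.2).2
      linarith [hx.1]
  simp only [intervalIntegral.integral_const, smul_eq_mul, mul_one] at i2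
  rw [← intervalIntegral.integral_add_adjacent_intervals (b := (M:ℝ))
      ((FF_cont μ).intervalIntegrable _ _) ((FF_cont μ).intervalIntegrable _ _)]
  rw [abs_le] at h1 ⊢
  constructor <;> linarith [h1.1, h1.2, hb.1, hb.2]

lemma gfun_abs (t : ℝ) : gfun t - max 0 (-t) = gfun |t| := by
  rcases le_total 0 t with h | h
  · rw [abs_of_nonneg h, max_eq_left (by linarith)]; ring
  · rw [abs_of_nonpos h, max_eq_right (by linarith), gfun_neg]; ring

lemma gfun_nonneg (t : ℝ) (h0 : 0 ≤ t) (h1 : t ≤ 1) : 0 ≤ gfun t := by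
  have := (FF_bounds 1 t one_pos h0 h1).1
  simpa [FF] using this

lemma vol_Omega : (volume OmegaSet).toReal = 2 * ∫ t in (0:ℝ)..1, gfun t := by
  have hc : IsClosed OmegaSet := by
    have := gfun_cont
    have e : OmegaSet = {p : ℝ × ℝ | -1 ≤ p.1} ∩ ({p : ℝ × ℝ | p.1 ≤ 1} ∩
        ({p : ℝ × ℝ | max 0 (-p.1) ≤ p.2} ∩ {p : ℝ × ℝ | p.2 ≤ gfun p.1})) := by
      ext p; rfl
    rw [e]
    exact (isClosed_le (by fun_prop) (by fun_prop)).inter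
      ((isClosed_le (by fun_prop) (by fun_prop)).inter
        ((isClosed_le (by fun_prop) (by fun_prop)).inter
          (isClosed_le (by fun_prop) (by fun_prop))))
  have hg := gfun_cont
  have hs : ∀ t : ℝ, volume (Prod.mk t ⁻¹' OmegaSet) =
      (Icc (-1:ℝ) 1).indicator (fun t => ENNReal.ofReal (gfun |t|)) t := by
    intro t
    by_cases ht : t ∈ Icc (-1:ℝ) 1
    · rw [indicator_of_mem ht]
      have : Prod.mk t ⁻¹' OmegaSet = Icc (max 0 (-t)) (gfun t) := by
        ext s
        simp only [OmegaSet, mem_preimage, mem_ofPred_eq, mem_Icc]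
        exact ⟨fun h => h.2.2, fun h => ⟨ht.1, ht.2, h⟩⟩
      rw [this, Real.volume_Icc, gfun_abs]
    · rw [indicator_of_notMem ht]
      have : Prod.mk t ⁻¹' OmegaSet = ∅ := by
        ext s
        simp only [OmegaSet, mem_preimage, mem_ofPred_eq, mem_empty_iff_false, iff_false]
        exact fun h => ht ⟨h.1, h.2.1⟩
      rw [this, measure_empty]
  rw [Measure.volume_eq_prod, Measure.prod_apply hc.measurableSet]
  simp_rw [hs]
  rw [lintegral_indicator measurableSet_Icc]
  rw [← integral_eq_lintegral_of_nonneg_ae]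
  · rw [integral_Icc_eq_integral_Ioc, ← intervalIntegral.integral_of_le (by norm_num)]
    have hi : ∀ a b : ℝ, IntervalIntegrable (fun t => gfun |t|) volume a b :=
      fun a b => Continuous.intervalIntegrable (by fun_prop) _ _
    rw [← intervalIntegral.integral_add_adjacent_intervals (hi (-1) 0) (hi 0 1)]
    have e1 : ∫ t in (0:ℝ)..1, gfun |t| = ∫ t in (0:ℝ)..1, gfun t := by
      apply intervalIntegral.integral_congr
      intro t ht
      rw [uIcc_of_le (by norm_num)] at ht
      simp only [abs_of_nonneg ht.1]
    have e2 : ∫ t in (-1:ℝ)..0, gfun |t| = ∫ t in (0:ℝ)..1, gfun |t| := by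
      have := intervalIntegral.integral_comp_neg (a := 0) (b := 1) (fun t => gfun |t|)
      simp only [abs_neg, neg_zero] at this
      exact this.symm
    rw [e2, e1]; ring
  · rw [Filter.EventuallyLE, ae_restrict_iff' measurableSet_Icc]
    refine Filter.Eventually.of_forall (fun t ht => ?_)
    exact gfun_nonneg _ (abs_nonneg _) (abs_le.2 ht)
  · exact Continuous.aestronglyMeasurable (by fun_prop)

lemma vol_scaled (μ : ℝ) (hμ : 0 < μ) :
    (volume OmegaSet).toReal * μ^2 = 2 * ∫ x in (0:ℝ)..μ, FF μ x := by
  rw [vol_Omega]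
  unfold FF
  rw [intervalIntegral.integral_const_mul, intervalIntegral.integral_comp_div _ hμ.ne']
  rw [zero_div, div_self hμ.ne', smul_eq_mul]
  ring

noncomputable def bb (μ : ℝ) (n : ℕ) : ℤ := ⌊FF μ n + 1/4⌋

lemma FF_int (μ : ℝ) (hμ : 0 < μ) (m : ℤ) :
    FF μ m = FF μ m.natAbs + ((max 0 (-m) : ℤ) : ℝ) := by
  have h := gfun_abs ((m:ℝ) / μ)
  have e : |(m:ℝ) / μ| = (m.natAbs : ℝ) / μ := by
    rw [abs_div, abs_of_pos hμ, Nat.cast_natAbs, Int.cast_abs]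
  have e2 : μ * max 0 (-((m:ℝ) / μ)) = ((max 0 (-m) : ℤ) : ℝ) := by
    rw [mul_max_of_nonneg _ _ hμ.le]; push_cast; congr 1
    · ring
    · field_simp
  unfold FF
  rw [← e, ← h, ← e2]; ring

lemma mem_iff (μ : ℝ) (hμ : 0 < μ) (m n : ℤ) :
    (((m : ℝ)), ((n : ℝ) - 1/4)) ∈ μ • OmegaSet ↔
      m ∈ Finset.Icc (-(⌊μ⌋₊ : ℤ)) ⌊μ⌋₊ ∧ n ∈ Finset.Ioc (max 0 (-m)) ⌊FF μ m + 1/4⌋ := by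
  rw [Set.mem_smul_set_iff_inv_smul_mem₀ hμ.ne']
  have e0 : (⌊μ⌋₊ : ℤ) = ⌊μ⌋ := Int.natCast_floor_eq_floor hμ.le
  rw [e0, Finset.mem_Icc, Finset.mem_Ioc, Int.le_floor, Int.le_floor, neg_le, Int.le_floor]
  have h1 : (-1 ≤ μ⁻¹ * (m:ℝ)) ↔ ((-m : ℤ) : ℝ) ≤ μ := by
    rw [inv_mul_eq_div, le_div_iff₀ hμ]; push_cast
    constructor <;> intro h <;> linarith
  have h2 : (μ⁻¹ * (m:ℝ) ≤ 1) ↔ (m : ℝ) ≤ μ := by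
    rw [inv_mul_eq_div, div_le_one hμ]
  have h3 : max 0 (-(μ⁻¹ * (m:ℝ))) ≤ μ⁻¹ * ((n:ℝ) - 1/4) ↔ max 0 (-m) < n := by
    have : max 0 (-(μ⁻¹ * (m:ℝ))) = μ⁻¹ * ((max 0 (-m) : ℤ) : ℝ) := by
      push_cast
      rw [mul_max_of_nonneg _ _ (by positivity)]; congr 1 <;> ring
    rw [this, mul_le_mul_iff_right₀ (by positivity)]
    constructor
    · intro h
      have : ((max 0 (-m) : ℤ) : ℝ) < n := by linarith
      exact_mod_cast this
    · intro h
      have : ((max 0 (-m) + 1 : ℤ) : ℝ) ≤ n := by exact_mod_cast h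
      push_cast at this ⊢; linarith
  have h4 : μ⁻¹ * ((n:ℝ) - 1/4) ≤ gfun (μ⁻¹ * (m:ℝ)) ↔ (n:ℝ) ≤ FF μ m + 1/4 := by
    unfold FF
    rw [inv_mul_le_iff₀ hμ, inv_mul_eq_div]
    constructor <;> intro h <;> linarith
  show (-1 ≤ μ⁻¹ * (m:ℝ) ∧ μ⁻¹ * (m:ℝ) ≤ 1 ∧ max 0 (-(μ⁻¹ * (m:ℝ))) ≤ μ⁻¹ * ((n:ℝ) - 1/4) ∧
    μ⁻¹ * ((n:ℝ) - 1/4) ≤ gfun (μ⁻¹ * (m:ℝ))) ↔ _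
  rw [h1, h2, h3, h4]
  tauto

lemma NOmega_eq (μ : ℝ) (hμ : 0 < μ) :
    (NOmega μ : ℤ) = ∑ m ∈ Finset.Icc (-(⌊μ⌋₊ : ℤ)) ⌊μ⌋₊, bb μ m.natAbs := by
  set S : Finset ((_ : ℤ) × ℤ) := (Finset.Icc (-(⌊μ⌋₊ : ℤ)) ⌊μ⌋₊).sigma
    (fun m => Finset.Ioc (max 0 (-m)) ⌊FF μ m + 1/4⌋) with hS
  have h : {p : ℤ × ℤ | (((p.1 : ℝ)), ((p.2 : ℝ) - 1/4)) ∈ μ • OmegaSet} =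
      ((S.map (Equiv.sigmaEquivProd ℤ ℤ).toEmbedding : Finset (ℤ × ℤ)) : Set (ℤ × ℤ)) := by
    ext ⟨m, n⟩
    refine (mem_iff μ hμ m n).trans ?_
    rw [Finset.mem_coe, Finset.mem_map_equiv, hS, Finset.mem_sigma]
    rfl
  unfold NOmega
  rw [h, Set.ncard_coe_finset, Finset.card_map, hS, Finset.card_sigma]
  push_cast
  apply Finset.sum_congr rfl
  intro m hm
  have hm' : (m.natAbs : ℝ) ≤ μ := by
    have : m.natAbs ≤ ⌊μ⌋₊ := by rw [Finset.mem_Icc] at hm; omega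
    exact (Nat.cast_le.2 this).trans (Nat.floor_le hμ.le)
  have hb : 0 ≤ bb μ m.natAbs := by
    unfold bb
    have := (FF_bounds μ m.natAbs hμ (by positivity) hm').1
    exact Int.floor_nonneg.2 (by linarith)
  have e : ⌊FF μ m + 1/4⌋ = bb μ m.natAbs + max 0 (-m) := by
    unfold bb
    rw [FF_int μ hμ m, add_right_comm, Int.floor_add_intCast]
  rw [Int.card_Ioc, e, add_sub_cancel_right, Int.toNat_of_nonneg hb]

lemma sum_sym (b : ℕ → ℤ) (M : ℕ) :
    ∑ m ∈ Finset.Icc (-(M : ℤ)) M, b m.natAbs =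
      2 * ∑ n ∈ Finset.range M, b n - b 0 + 2 * b M := by
  induction M with
  | zero => simp; ring
  | succ M ih =>
    have e : Finset.Icc (-((M+1 : ℕ) : ℤ)) ((M+1 : ℕ) : ℤ) =
        insert (-((M+1 : ℕ) : ℤ)) (insert ((M+1 : ℕ) : ℤ) (Finset.Icc (-(M : ℤ)) M)) := by
      ext x; simp only [Finset.mem_insert, Finset.mem_Icc]; push_cast; omega
    rw [e, Finset.sum_insert, Finset.sum_insert, ih, Finset.sum_range_succ, Int.natAbs_neg,
      Int.natAbs_natCast]
    · ring
    · simp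
    · simp only [Finset.mem_insert, Finset.mem_Icc]; push_cast; omega

lemma psi_FF (μ : ℝ) (hμ : 1 < μ) :
    |∑ n ∈ Finset.range ⌊μ⌋₊, psi (FF μ n + 1/4)| ≤ 241 * μ ^ ((2:ℝ)/3) := by
  have hμ0 : 0 < μ := by linarith
  have hp := Real.pi_pos
  have hp3 := Real.pi_gt_three
  have hp4 := Real.pi_lt_four
  have hfl := Nat.floor_le hμ0.le
  set c := μ ^ ((1:ℝ)/3) with hc
  have hc1 : 1 ≤ c := Real.one_le_rpow hμ.le (by norm_num)
  have hc3 : c ^ 3 = μ := by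
    rw [hc, ← Real.rpow_natCast, ← Real.rpow_mul hμ0.le]; norm_num
  have hc2 : μ ^ ((2:ℝ)/3) = c ^ 2 := by
    rw [hc, ← Real.rpow_natCast, ← Real.rpow_mul hμ0.le]; norm_num
  set H := ⌈c⌉₊ with hH
  have hHc : c ≤ H := Nat.le_ceil c
  have hH2 : (H:ℝ) ≤ 2 * c := by
    have := Nat.ceil_lt_add_one (by linarith : 0 ≤ c)
    linarith
  have hH1 : 1 ≤ H := by
    have : (1:ℝ) ≤ H := hc1.trans hHc
    exact_mod_cast this
  have l0 : 0 < 1 / (π * μ) := by positivity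
  have hE : ∀ h : ℕ, 1 ≤ h → ‖∑ n ∈ Finset.range ⌊μ⌋₊, ee (h * (FF μ n + 1/4))‖ ≤
      (10 * √(1 / (1 / (π * μ)))) * √h := by
    intro h hh
    apply expsum (fun n => FF μ n + 1/4) ⌊μ⌋₊ (1 / (π * μ)) l0 _ _ _ h hh
    · rw [one_div_one_div]; nlinarith
    · intro n hn
      have hn' : ((n + 2 : ℕ) : ℝ) ≤ μ := (Nat.cast_le.2 (by omega : n + 2 ≤ ⌊μ⌋₊)).trans hfl
      push_cast at hn'
      have := FF_second μ n hμ0 (by positivity) hn'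
      push_cast
      linarith
    · intro n hn
      have hn' : ((n + 1 : ℕ) : ℝ) ≤ μ := (Nat.cast_le.2 (by omega : n + 1 ≤ ⌊μ⌋₊)).trans hfl
      push_cast at hn' ⊢
      have hn0 : (0:ℝ) ≤ n := by positivity
      obtain ⟨ξ, h1, h2, h3⟩ := FF_mvt μ n (n+1) hμ0 hn0 (by linarith) hn'
      have a := dF_le μ ξ
      have b := dF_ge μ ξ hμ0 (by linarith)
      rw [add_sub_cancel_left, mul_one] at h3
      constructor <;> linarith
  have := psi_sum (fun n => FF μ n + 1/4) ⌊μ⌋₊ H hH1 _ (by positivity) hE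
  refine this.trans ?_
  rw [hc2]
  have t1 : (⌊μ⌋₊ : ℝ) / H ≤ c ^ 2 := by
    rw [div_le_iff₀ (by linarith)]
    nlinarith [sq_nonneg c]
  have t2 : √(1 / (1 / (π * μ))) * √H ≤ 6 * c ^ 2 := by
    rw [one_div_one_div, ← Real.sqrt_mul (by positivity)]
    apply Real.sqrt_le_iff.2 ⟨by positivity, ?_⟩
    calc π * μ * H ≤ 4 * μ * (2 * c) := by gcongr
      _ = 8 * c ^ 4 := by rw [← hc3]; ring
      _ ≤ _ := by nlinarith [sq_nonneg (c^2)]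
  nlinarith

theorem lattice_remainder_2 :
    ∃ C : ℝ, 0 < C ∧ ∀ μ : ℝ, 1 < μ →
      |(NOmega μ : ℝ) - (MeasureTheory.volume OmegaSet).toReal * μ^2 + μ/2| ≤
        C * μ ^ ((2:ℝ)/3) := by
  refine ⟨500, by norm_num, fun μ hμ => ?_⟩
  have hμ0 : 0 < μ := by linarith
  have hfl := Nat.floor_le hμ0.le
  have hfl2 := Nat.lt_floor_add_one μ
  have hN : (NOmega μ : ℝ) = 2 * ∑ n ∈ Finset.range ⌊μ⌋₊, (bb μ n : ℝ) - bb μ 0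
      + 2 * bb μ ⌊μ⌋₊ := by
    have := NOmega_eq μ hμ0
    rw [sum_sym] at this
    exact_mod_cast this
  have hbb : ∀ n : ℕ, (bb μ n : ℝ) = FF μ n - 1/4 - psi (FF μ n + 1/4) := by
    intro n
    unfold bb psi Int.fract
    ring
  have hpsi : ∀ x, |psi x| ≤ 1/2 := by
    intro x
    have h0 := Int.fract_nonneg x
    have h1 := Int.fract_lt_one x
    unfold psi
    rw [abs_le]; constructor <;> linarith
  have hsum : ∑ n ∈ Finset.range ⌊μ⌋₊, (bb μ n : ℝ) = ∑ n ∈ Finset.range ⌊μ⌋₊, FF μ n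
      - ⌊μ⌋₊ / 4 - ∑ n ∈ Finset.range ⌊μ⌋₊, psi (FF μ n + 1/4) := by
    simp_rw [hbb]
    rw [Finset.sum_sub_distrib, Finset.sum_sub_distrib, Finset.sum_const, Finset.card_range,
      nsmul_eq_mul]
    ring
  have h1 := abs_le.1 (trap_full μ hμ0 ⌊μ⌋₊ hfl hfl2)
  have h2 := abs_le.1 (psi_FF μ hμ)
  have h3 := FF_bounds μ ⌊μ⌋₊ hμ0 (by positivity) hfl
  have h4 := abs_le.1 (hpsi (FF μ (0:ℕ) + 1/4))
  have h5 := abs_le.1 (hpsi (FF μ ⌊μ⌋₊ + 1/4))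
  have h6 : 1 ≤ μ ^ ((2:ℝ)/3) := Real.one_le_rpow hμ.le (by norm_num)
  rw [hN, vol_scaled μ hμ0, hsum, hbb 0, hbb ⌊μ⌋₊]
  rw [Nat.cast_zero] at h4 ⊢
  rw [abs_le]
  constructor <;> linarith [h1.1, h1.2, h2.1, h2.2, h3.1, h3.2, h4.1, h4.2, h5.1, h5.2]
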